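/- arXiv:2401.01793 — 12 statements merged into one kernel-verified Lean document; each statement's English description precedes it below -/
import Mathlib

section
/- Let m and n be nonempty finite types with at least 2 elements each, and let H be a Hermitian matrix in Matrix (m × n) (m × n) ℂ. Then there exists a skew-Hermitian matrix X in Matrix (m × n) (m × n) ℂ (i.e., Xᴴ = -X) such that X commutes with H (X * H = H * X), but X cannot be written in the local form A ⊗ₖ 1 + 1 ⊗ₖ B for any matrices A : Matrix m m ℂ and B : Matrix n n ℂ. (This is the Lie-algebra form of the paper's Theorem 1: the symmetries of a bipartite Hamiltonian are not all symmetries of the tensor product structure, so the Hamiltonian's spectrum cannot uniquely determine the tensor product structure.) -/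
open Matrix Kronecker

/-- A nonzero rank-one matrix `u wᵀ` whose factors have the same support is not of the local form
`A ⊗ 1 + 1 ⊗ B`. -/
theorem vecMulVec_ne_kronecker_one_add_one_kronecker {m n R : Type*} [DecidableEq m]
    [DecidableEq n] [Nontrivial m] [Nontrivial n] [Ring R] [NoZeroDivisors R] {u w : m × n → R}
    (huw : ∀ p, u p = 0 ↔ w p = 0) (hu : u ≠ 0) (A : Matrix m m R) (B : Matrix n n R) :
    vecMulVec u w ≠ A ⊗ₖ (1 : Matrix n n R) + (1 : Matrix m m R) ⊗ₖ B := by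
  intro h
  obtain ⟨⟨a, b⟩, hab⟩ := Function.ne_iff.mp hu
  obtain ⟨c, hc⟩ := exists_ne a
  obtain ⟨d, hd⟩ := exists_ne b
  have entry (p q : m × n) : u p * w q =
      A p.1 q.1 * (1 : Matrix n n R) p.2 q.2 + (1 : Matrix m m R) p.1 q.1 * B p.2 q.2 :=
    congrFun (congrFun h p) q
  have hcd : w (c, d) = 0 := by
    have := entry (a, b) (c, d)
    simpa [one_apply_ne, hc.symm, hd.symm, show u (a, b) ≠ 0 from hab] using this
  have had : w (a, d) = 0 := by
    have h₁ := entry (a, b) (a, d)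
    have h₂ := entry (c, b) (c, d)
    simp only [one_apply_ne hd.symm, one_apply_eq, mul_zero, one_mul, zero_add, hcd] at h₁ h₂
    exact (mul_eq_zero.mp (h₁.trans h₂.symm)).resolve_left hab
  have hcb : w (c, b) = 0 := by
    have h₁ := entry (a, b) (c, b)
    have h₂ := entry (a, d) (c, d)
    simp only [one_apply_ne hc.symm, one_apply_eq, mul_one, zero_mul, mul_zero, add_zero, hcd]
      at h₁ h₂
    exact (mul_eq_zero.mp (h₁.trans h₂.symm)).resolve_left hab
  have h₁ := entry (a, b) (a, b)
  have h₂ := entry (c, d) (c, d)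
  have h₃ := entry (a, d) (a, d)
  have h₄ := entry (c, b) (c, b)
  simp only [one_apply_eq, mul_one, one_mul, mul_zero, hcd, had, hcb] at h₁ h₂ h₃ h₄
  have hzero : u (a, b) * w (a, b) = 0 := by
    have : A a a + B b b = (A a a + B d d) + (A c c + B b b) - (A c c + B d d) := by abel
    rw [h₁, this, ← h₂, ← h₃, ← h₄]
    simp
  exact (mul_ne_zero hab (mt (huw _).mpr hab)) hzero

/-- The rank-one matrix `v vᴴ` of an eigenvector `v` of a Hermitian matrix commutes with that
matrix. -/
theorem Matrix.IsHermitian.commute_vecMulVec_star {ι : Type*} [Fintype ι] {H : Matrix ι ι ℂ}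
    (hH : H.IsHermitian) {v : ι → ℂ} {r : ℝ} (hv : H *ᵥ v = r • v) :
    Commute (vecMulVec v (star v)) H := by
  have hv' : star v ᵥ* H = r • star v := by
    have := star_mulVec H v
    rw [hH.eq, hv] at this
    rw [← this, star_smul, star_trivial]
  rw [Commute, SemiconjBy, vecMulVec_mul, mul_vecMulVec, hv, hv', vecMulVec_smul, smul_vecMulVec]

theorem hamiltonian_symmetry_not_local
    {m n : Type*} [Fintype m] [Fintype n] [DecidableEq m] [DecidableEq n]
    (hm : 2 ≤ Fintype.card m) (hn : 2 ≤ Fintype.card n)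
    (H : Matrix (m × n) (m × n) ℂ) (hH : H.IsHermitian) :
    ∃ X : Matrix (m × n) (m × n) ℂ, Xᴴ = -X ∧ X * H = H * X ∧
      ¬ ∃ (A : Matrix m m ℂ) (B : Matrix n n ℂ), X = A ⊗ₖ (1 : Matrix n n ℂ) + (1 : Matrix m m ℂ) ⊗ₖ B := by
  have : Nontrivial m := Fintype.one_lt_card_iff_nontrivial.mp hm
  have : Nontrivial n := Fintype.one_lt_card_iff_nontrivial.mp hn
  obtain ⟨p⟩ : Nonempty (m × n) := inferInstance
  have hHv := hH.mulVec_eigenvectorBasis p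
  have hv : (hH.eigenvectorBasis p : m × n → ℂ) ≠ 0 := fun h =>
    hH.eigenvectorBasis.orthonormal.ne_zero p (PiLp.ext (congrFun h))
  generalize (hH.eigenvectorBasis p : m × n → ℂ) = v at hHv hv
  refine ⟨Complex.I • vecMulVec v (star v), ?_, ?_, ?_⟩
  · rw [conjTranspose_smul, conjTranspose_vecMulVec, star_star]
    simp
  · exact ((hH.commute_vecMulVec_star hHv).smul_left Complex.I).eq
  · rintro ⟨A, B, h⟩
    rw [← smul_vecMulVec] at h
    exact vecMulVec_ne_kronecker_one_add_one_kronecker (by simp)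
      (smul_ne_zero Complex.I_ne_zero hv) A B h
end

section
/- Let m and n be finite types with at least 2 elements each, and let H be a Hermitian matrix in Matrix (m × n) (m × n) ℂ. Then there exists a unitary matrix S on Matrix (m × n) (m × n) ℂ commuting with H (S * H = H * S), and vectors v : m → ℂ and w : n → ℂ, such that the image S.mulVec (fun p => v p.1 * w p.2) is not a product vector, i.e., there exist no v' : m → ℂ and w' : n → ℂ with S.mulVec (fun p => v p.1 * w p.2) = fun p => v' p.1 * w' p.2. (Unitary form of the paper's Theorem 1: some symmetry of the Hamiltonian fails to preserve the tensor product structure, since it entangles a product state.) -/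
open Matrix Kronecker

/-- The `2 × 2` minors of a product vector vanish. -/
lemma minor_eq_zero_of_product {m n R : Type*} [CommRing R] {z : m × n → R}
    (h : ∃ (v : m → R) (w : n → R), z = fun p => v p.1 * w p.2) (i i' : m) (j j' : n) :
    z (i, j) * z (i', j') - z (i, j') * z (i', j) = 0 := by
  obtain ⟨v, w, rfl⟩ := h
  ring

/-- Multiplying the component along a unit vector by a phase is a unitary operation. -/
lemma one_add_smul_vecMulVec_mem_unitaryGroup {ι : Type*} [Fintype ι] [DecidableEq ι]
    {e : ι → ℂ} (he : star e ⬝ᵥ e = 1) {z : ℂ} (hz : z * star z = 1) :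
    1 + (z - 1) • vecMulVec e (star e) ∈ unitaryGroup ι ℂ := by
  have hP : vecMulVec e (star e) * vecMulVec e (star e) = vecMulVec e (star e) := by
    rw [vecMulVec_mul_vecMulVec, he, one_smul]
  have hstar : star (vecMulVec e (star e)) = vecMulVec e (star e) := by
    rw [star_eq_conjTranspose, conjTranspose_vecMulVec, star_star]
  rw [mem_unitaryGroup_iff, star_add, star_smul, star_one, hstar]
  simp only [add_mul, mul_add, one_mul, mul_one, smul_mul_smul_comm, hP]
  rw [add_assoc, ← add_smul, ← add_smul]
  convert add_zero (1 : Matrix ι ι ℂ)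
  convert zero_smul ℂ (vecMulVec e (star e))
  rw [star_sub, star_one]
  linear_combination hz

/-- The rank one projection onto an eigenvector of a Hermitian matrix commutes with it. -/
lemma Matrix.IsHermitian.commute_vecMulVec {ι : Type*} [Fintype ι]
    {H : Matrix ι ι ℂ} (hH : H.IsHermitian) {e : ι → ℂ} {μ : ℝ} (he : H *ᵥ e = μ • e) :
    Commute (vecMulVec e (star e)) H := by
  have h : star e ᵥ* H = μ • star e := by
    rw [← hH.eq, ← star_mulVec, he, star_smul, star_trivial μ]
  rw [commute_iff_eq, vecMulVec_mul, mul_vecMulVec, h, he, smul_vecMulVec, vecMulVec_smul]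

/-- A polynomial of degree at most two with nonzero constant coefficient and one with nonzero
quadratic coefficient have a common nonroot. -/
lemma exists_quadratic_ne_zero (a b c a' b' c' : ℂ) (ha : a ≠ 0) (ha' : a' ≠ 0) :
    ∃ s : ℂ, c * s ^ 2 + b * s + a ≠ 0 ∧ a' * s ^ 2 + b' * s + c' ≠ 0 := by
  open Polynomial in
  let p : ℂ[X] := C c * X ^ 2 + C b * X + C a
  let q : ℂ[X] := C a' * X ^ 2 + C b' * X + C c'
  have hp : p ≠ 0 := fun h => ha (by simpa [p] using congrArg (coeff · 0) h)
  have hq : q ≠ 0 := fun h => ha' (by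
    simpa [q, coeff_X, coeff_C] using congrArg (coeff · 2) h)
  by_contra! h
  refine mul_ne_zero hp hq (Polynomial.funext fun s => ?_)
  by_cases hs : c * s ^ 2 + b * s + a = 0
  · have : p.eval s = 0 := by simpa [p] using hs
    simp [this]
  · have : q.eval s = 0 := by simpa [q] using h s hs
    simp [this]

/-- For a nonzero vector `e`, some product vector `x` is not orthogonal to `e`, and the line through
`x` in direction `e` contains product vectors for at most one nonzero parameter. -/
lemma exists_product_line_not_product {m n : Type*} [Fintype m] [Fintype n]
    [DecidableEq m] [DecidableEq n] [Nontrivial m] [Nontrivial n]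
    {e : m × n → ℂ} (he : e ≠ 0) :
    ∃ (v : m → ℂ) (w : n → ℂ), star e ⬝ᵥ (fun p => v p.1 * w p.2) ≠ 0 ∧
      ∀ t t' : ℂ, t ≠ 0 → t' ≠ 0 → t ≠ t' →
        (∃ (v' : m → ℂ) (w' : n → ℂ),
          (fun p => v p.1 * w p.2) + t • e = fun p => v' p.1 * w' p.2) →
        ¬ ∃ (v' : m → ℂ) (w' : n → ℂ),
          (fun p => v p.1 * w p.2) + t' • e = fun p => v' p.1 * w' p.2 := by
  obtain ⟨⟨i, j⟩, hij⟩ := Function.ne_iff.mp he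
  obtain ⟨i', hi⟩ := exists_ne i
  obtain ⟨j', hj⟩ := exists_ne j
  obtain ⟨s, hs, hs'⟩ := exists_quadratic_ne_zero (e (i, j)) (-(e (i, j') + e (i', j)))
    (e (i', j')) (star (e (i, j))) (star (e (i, j')) + star (e (i', j))) (star (e (i', j')))
    hij (star_ne_zero.mpr hij)
  refine ⟨Pi.single i s + Pi.single i' 1, Pi.single j s + Pi.single j' 1, ?_, ?_⟩
  · convert hs' using 1
    simp only [dotProduct, Fintype.sum_prod_type, Pi.add_apply, Pi.star_apply, mul_add, add_mul,
      Finset.sum_add_distrib, Pi.single_apply, mul_ite, ite_mul, mul_zero, zero_mul, mul_one,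
      Finset.sum_ite_eq', Finset.mem_univ, if_true]
    ring
  · intro t t' ht ht' htt h h'
    have h₁ := minor_eq_zero_of_product h i i' j j'
    have h₂ := minor_eq_zero_of_product h' i i' j j'
    simp only [Pi.add_apply, Pi.smul_apply, Pi.single_eq_same, Pi.single_eq_of_ne hi,
      Pi.single_eq_of_ne hj, Pi.single_eq_of_ne hi.symm, Pi.single_eq_of_ne hj.symm,
      smul_eq_mul, add_zero, zero_add] at h₁ h₂
    apply hs
    have : t * t' * (t' - t) ≠ 0 := mul_ne_zero (mul_ne_zero ht ht') (sub_ne_zero.mpr htt.symm)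
    refine (mul_eq_zero.mp ?_).resolve_left this
    linear_combination t' ^ 2 * h₁ - t ^ 2 * h₂

theorem hamiltonian_symmetry_entangles
    {m n : Type*} [Fintype m] [Fintype n] [DecidableEq m] [DecidableEq n]
    (hm : 2 ≤ Fintype.card m) (hn : 2 ≤ Fintype.card n)
    (H : Matrix (m × n) (m × n) ℂ) (hH : H.IsHermitian) :
    ∃ S ∈ Matrix.unitaryGroup (m × n) ℂ, S * H = H * S ∧
      ∃ (v : m → ℂ) (w : n → ℂ),
        ¬ ∃ (v' : m → ℂ) (w' : n → ℂ),
          S.mulVec (fun p => v p.1 * w p.2) = fun p => v' p.1 * w' p.2 := by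
  have : Nontrivial m := Fintype.one_lt_card_iff_nontrivial.mp hm
  have : Nontrivial n := Fintype.one_lt_card_iff_nontrivial.mp hn
  obtain ⟨k⟩ : Nonempty (m × n) := inferInstance
  set e : m × n → ℂ := ⇑(hH.eigenvectorBasis k)
  have he : star e ⬝ᵥ e = 1 := by
    have := inner_self_eq_one_of_norm_eq_one (𝕜 := ℂ) (hH.eigenvectorBasis.orthonormal.1 k)
    rwa [EuclideanSpace.inner_eq_star_dotProduct, dotProduct_comm] at this
  have he0 : e ≠ 0 := by
    intro h
    simp [h] at he
  obtain ⟨v, w, hc, hvw⟩ := exists_product_line_not_product he0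
  set c := star e ⬝ᵥ (fun p => v p.1 * w p.2)
  by_contra! hcon
  have key (z : ℂ) (hz : z * star z = 1) : ∃ (v' : m → ℂ) (w' : n → ℂ),
      (fun p => v p.1 * w p.2) + ((z - 1) * c) • e = fun p => v' p.1 * w' p.2 := by
    have hcomm : Commute (1 + (z - 1) • vecMulVec e (star e)) H :=
      (Commute.one_left H).add_left
        ((hH.commute_vecMulVec (hH.mulVec_eigenvectorBasis k)).smul_left _)
    obtain ⟨v', w', h⟩ := hcon _ (one_add_smul_vecMulVec_mem_unitaryGroup he hz) hcomm.eq v w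
    refine ⟨v', w', ?_⟩
    rw [← h, add_mulVec, one_mulVec, smul_mulVec, vecMulVec_mulVec, op_smul_eq_smul, smul_smul]
  have hI : Complex.I - 1 ≠ 0 := fun h => by simpa using congrArg Complex.im h
  refine hvw ((-1 - 1) * c) ((Complex.I - 1) * c) (mul_ne_zero (by norm_num) hc)
    (mul_ne_zero hI hc) (fun h => ?_) (key (-1) (by simp)) (key Complex.I (by simp))
  simpa using congrArg Complex.im (mul_right_cancel₀ hc h)
end

section
/- Let n be a nonempty finite type with decidable equality and H : Matrix n n ℂ a Hermitian matrix with eigenvalue function λ := hH.eigenvalues : n → ℝ (listing eigenvalues with multiplicity). Then the complex dimension of the commutant of H, i.e., finrank ℂ of the subalgebra {A : Matrix n n ℂ | A * H = H * A} (the centralizer of {H} in the matrix algebra), equals the number of pairs (i, j) : n × n with λ i = λ j. Equivalently, it equals the sum over the distinct eigenvalues of the squares of their multiplicities. -/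
open Matrix
open scoped Classical

theorem AlgEquiv.finrank_centralizer_singleton {K A B : Type*} [Field K] [Ring A] [Ring B]
    [Algebra K A] [Algebra K B] (e : A ≃ₐ[K] B) (a : A) :
    Module.finrank K (Subalgebra.centralizer K {a}) =
      Module.finrank K (Subalgebra.centralizer K {e a}) := by
  have h : (Subalgebra.centralizer K {a}).map (e : A →ₐ[K] B) =
      Subalgebra.centralizer K {e a} := by
    ext b
    obtain ⟨c, rfl⟩ := e.surjective b
    simp [Subalgebra.mem_centralizer_iff, ← map_mul]
  rw [← h]
  exact (e.subalgebraMap _).toLinearEquiv.finrank_eq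

theorem Matrix.mem_centralizer_diagonal_iff {K n : Type*} [Field K] [Fintype n] [DecidableEq n]
    {d : n → K} {A : Matrix n n K} :
    A ∈ Subalgebra.centralizer K {diagonal d} ↔ ∀ i j, d i ≠ d j → A i j = 0 := by
  simp only [Subalgebra.mem_centralizer_iff, Set.mem_singleton_iff, forall_eq]
  simp only [← Matrix.ext_iff, diagonal_mul, mul_diagonal]
  refine forall₂_congr fun i j => ?_
  rw [mul_comm (A i j), mul_eq_mul_right_iff]
  tauto

/-- A matrix commuting with `diagonal d` is determined by its entries `(i, j)` with `d i = d j`,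
which are arbitrary. -/
noncomputable def Matrix.centralizerDiagonalEquiv {K n : Type*} [Field K] [Fintype n]
    [DecidableEq n] (d : n → K) :
    Subalgebra.centralizer K {diagonal d} ≃ₗ[K] ({p : n × n // d p.1 = d p.2} → K) where
  toFun A p := A.1 p.1.1 p.1.2
  map_add' _ _ := rfl
  map_smul' _ _ := rfl
  invFun f := ⟨of fun i j => if h : d i = d j then f ⟨(i, j), h⟩ else 0,
    mem_centralizer_diagonal_iff.2 fun _ _ h => dif_neg h⟩
  left_inv A := by
    ext i j
    by_cases h : d i = d j
    · simp [h]
    · simp [h, mem_centralizer_diagonal_iff.1 A.2 i j h]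
  right_inv f := by
    ext ⟨_, h⟩
    simp [h]

theorem finrank_commutant_eq_card_eigenvalue_pairs
    {n : Type*} [Fintype n] [Nonempty n] [DecidableEq n]
    (H : Matrix n n ℂ) (hH : H.IsHermitian) :
    Module.finrank ℂ (Subalgebra.centralizer ℂ ({H} : Set (Matrix n n ℂ))) =
      Finset.card (Finset.univ.filter
        fun p : n × n => hH.eigenvalues p.1 = hH.eigenvalues p.2) := by
  conv_lhs => rw [hH.spectral_theorem]
  refine ((Unitary.conjStarAlgAut ℂ _ hH.eigenvectorUnitary).toAlgEquiv
    |>.finrank_centralizer_singleton _).symm.trans ?_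
  rw [(centralizerDiagonalEquiv _).finrank_eq, Module.finrank_fintype_fun_eq_card,
    Fintype.card_subtype]
  simp
end

section
/- Let n be a nonempty finite type with N := Fintype.card n, and let H : Matrix n n ℂ be a Hermitian matrix. Then the complex dimension of the commutant of H satisfies N ≤ finrank ℂ {A : Matrix n n ℂ | A * H = H * A} ≤ N². (This is inequality (7) of the paper bounding the dimension of the symmetry group of the Hamiltonian.) -/
open Matrix

/-- Conjugation by an algebra automorphism that diagonalizes `H` embeds the diagonal matrices
into the commutant of `H`. -/
theorem card_le_finrank_centralizer_of_eq_map_diagonal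
    {K n : Type*} [Field K] [Fintype n] [DecidableEq n]
    (φ : Matrix n n K ≃ₐ[K] Matrix n n K) (d : n → K) :
    Fintype.card n ≤
      Module.finrank K
        (Subalgebra.centralizer K ({φ (Matrix.diagonal d)} : Set (Matrix n n K))) := by
  let S := Subalgebra.centralizer K ({φ (Matrix.diagonal d)} : Set (Matrix n n K))
  let f : (n → K) →ₗ[K] S :=
    (φ.toLinearMap ∘ₗ Matrix.diagonalLinearMap n K K).codRestrict (Subalgebra.toSubmodule S)
      fun c => by
        rw [Subalgebra.mem_toSubmodule, Subalgebra.mem_centralizer_iff]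
        rintro _ rfl
        simp [← map_mul, Matrix.diagonal_mul_diagonal, mul_comm]
  have hf : Function.Injective f := fun a b hab =>
    Matrix.diagonal_injective (φ.injective (congrArg Subtype.val hab))
  simpa using LinearMap.finrank_le_finrank_of_injective hf

theorem finrank_commutant_bounds
    {n : Type*} [Fintype n] [Nonempty n] [DecidableEq n]
    (H : Matrix n n ℂ) (hH : H.IsHermitian) :
    Fintype.card n ≤
        Module.finrank ℂ (Subalgebra.centralizer ℂ ({H} : Set (Matrix n n ℂ))) ∧
      Module.finrank ℂ (Subalgebra.centralizer ℂ ({H} : Set (Matrix n n ℂ))) ≤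
        (Fintype.card n) ^ 2 := by
  constructor
  · have h := card_le_finrank_centralizer_of_eq_map_diagonal
      (Unitary.conjStarAlgAut ℂ _ hH.eigenvectorUnitary).toAlgEquiv
      (RCLike.ofReal ∘ hH.eigenvalues)
    have hspec : (Unitary.conjStarAlgAut ℂ _ hH.eigenvectorUnitary).toAlgEquiv
        (Matrix.diagonal (RCLike.ofReal ∘ hH.eigenvalues)) = H := hH.spectral_theorem.symm
    rwa [hspec] at h
  · have h := Submodule.finrank_le
      (Subalgebra.toSubmodule (Subalgebra.centralizer ℂ ({H} : Set (Matrix n n ℂ))))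
    rwa [Module.finrank_matrix, Module.finrank_self, mul_one, ← sq] at h
end

section
/- Let n be a nonempty finite type with decidable equality, N := Fintype.card n, and let H : Matrix n n ℂ be a Hermitian matrix. Then finrank ℂ {A : Matrix n n ℂ | A * H = H * A} = N² if and only if H is a real scalar multiple of the identity, i.e., there exists c : ℝ with H = (c : ℂ) • 1. (Attainment condition for the upper bound in inequality (7) of the paper: all eigenvalues equal.) -/
open Matrix

theorem finrank_commutant_eq_card_sq_iff_scalar
    {n : Type*} [Fintype n] [Nonempty n] [DecidableEq n]
    (H : Matrix n n ℂ) (hH : H.IsHermitian) :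
    Module.finrank ℂ (Subalgebra.centralizer ℂ ({H} : Set (Matrix n n ℂ))) =
        (Fintype.card n) ^ 2 ↔
      ∃ c : ℝ, H = (c : ℂ) • (1 : Matrix n n ℂ) := by
  have finrank_eq : Module.finrank ℂ (Matrix n n ℂ) = Fintype.card n ^ 2 := by
    rw [Module.finrank_matrix, Module.finrank_self, mul_one, sq]
  rw [← finrank_eq]
  constructor
  · intro h
    have htop : (Subalgebra.centralizer ℂ ({H} : Set (Matrix n n ℂ))).toSubmodule = ⊤ :=
      Submodule.eq_top_of_finrank_eq h
    have hcomm (A : Matrix n n ℂ) : H * A = A * H := by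
      have hA : A ∈ Subalgebra.centralizer ℂ ({H} : Set (Matrix n n ℂ)) := by
        rw [← Subalgebra.mem_toSubmodule, htop]
        trivial
      exact Subalgebra.mem_centralizer_iff ℂ |>.mp hA H rfl
    obtain ⟨z, rfl⟩ := mem_range_scalar_iff_commute_single'.mpr
      fun i j ↦ (hcomm (single i j 1)).symm
    obtain ⟨i⟩ := ‹Nonempty n›
    have hz : star z = z := by simpa using hH.apply i i
    obtain ⟨c, rfl⟩ := Complex.conj_eq_iff_real.mp hz
    exact ⟨c, (smul_one_eq_diagonal (c : ℂ)).symm⟩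
  · rintro ⟨c, rfl⟩
    have htop : Subalgebra.centralizer ℂ {(c : ℂ) • (1 : Matrix n n ℂ)} = ⊤ := by
      refine eq_top_iff.mpr fun A _ ↦ ?_
      simp [Subalgebra.mem_centralizer_iff]
    rw [htop]
    exact subalgebra_top_finrank_eq_submodule_top_finrank.trans (finrank_top ..)
end

section
/- Let n be a finite type and S a star-subalgebra of Matrix n n ℂ that is commutative (for all a, b ∈ S, a * b = b * a). Then finrank ℂ S ≤ Fintype.card n. (This supports the paper's claim that any commutative subgroup of the unitary group of an N-dimensional Hilbert space has dimension at most N, used in equation (6).) -/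
open Matrix

/-- Commuting families of symmetric operators admit a basis of joint eigenvectors. -/
theorem exists_basis_joint_eigenvectors {E ι : Type*} [NormedAddCommGroup E]
    [InnerProductSpace ℂ E] [FiniteDimensional ℂ E] {T : ι → E →ₗ[ℂ] E}
    (hT : ∀ i, (T i).IsSymmetric) (hC : Pairwise (Function.onFun Commute T)) :
    ∃ (s : Set E) (b : Module.Basis s ℂ E), ∀ i k, ∃ c : ℂ, T i (b k) = c • b k := by
  have hspan : ⊤ ≤ Submodule.span ℂ {v : E | ∀ i, ∃ c : ℂ, T i v = c • v} := by
    rw [← LinearMap.IsSymmetric.iSup_iInf_eq_top_of_commute hT hC]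
    refine iSup_le fun χ v hv => Submodule.subset_span fun i => ⟨χ i, ?_⟩
    exact Module.End.mem_eigenspace_iff.mp ((Submodule.mem_iInf _).mp hv i)
  refine ⟨_, Module.Basis.ofSpan hspan, fun i k => ?_⟩
  exact Module.Basis.ofSpan_subset hspan ⟨k, rfl⟩ i

/-- A space of endomorphisms that are all diagonal in a common basis has dimension at most the
dimension of the underlying space. -/
theorem finrank_le_of_forall_exists_smul_basis {K V κ : Type*} [Field K] [AddCommGroup V]
    [Module K V] [Module.Finite K V] (b : Module.Basis κ K V) (W : Submodule K (Module.End K V))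
    (hW : ∀ f ∈ W, ∀ k, ∃ c : K, f (b k) = c • b k) :
    Module.finrank K W ≤ Module.finrank K V := by
  have := Module.Finite.finite_basis b
  have := Fintype.ofFinite κ
  let d : W →ₗ[K] (κ → K) :=
    LinearMap.pi fun k => b.coord k ∘ₗ LinearMap.applyₗ (b k) ∘ₗ W.subtype
  have hd : Function.Injective d := by
    rw [← LinearMap.ker_eq_bot, LinearMap.ker_eq_bot']
    intro f hf
    refine Subtype.ext (b.ext fun k => ?_)
    obtain ⟨c, hc⟩ := hW f f.2 k
    have hk : b.coord k ((f : Module.End K V) (b k)) = 0 := congrFun hf k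
    have hc0 : c = 0 := by simpa [hc] using hk
    simp [hc, hc0]
  simpa [Module.finrank_eq_card_basis b] using LinearMap.finrank_le_finrank_of_injective hd

open scoped ComplexStarModule in
theorem finrank_commutative_starSubalgebra_le_card
    {n : Type*} [Fintype n] [DecidableEq n]
    (S : StarSubalgebra ℂ (Matrix n n ℂ))
    (hcomm : ∀ a ∈ S, ∀ b ∈ S, a * b = b * a) :
    Module.finrank ℂ S ≤ Fintype.card n := by
  let T : selfAdjoint S → EuclideanSpace ℂ n →ₗ[ℂ] EuclideanSpace ℂ n :=
    fun a => toEuclideanLin (a : S).1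
  have hT : ∀ a, (T a).IsSymmetric := fun a =>
    isSymmetric_toEuclideanLin_iff.mpr (congrArg Subtype.val a.2)
  have hC : Pairwise (Function.onFun Commute T) := fun a b _ => by
    have h := hcomm _ (a : S).2 _ (b : S).2
    refine LinearMap.ext fun v => ?_
    simp [T, toLpLin_apply, h]
  obtain ⟨_, b, hb⟩ := exists_basis_joint_eigenvectors hT hC
  let W := S.toSubalgebra.toSubmodule.map (toEuclideanLin (𝕜 := ℂ) (m := n) (n := n)).toLinearMap
  have hW : ∀ f ∈ W, ∀ k, ∃ c : ℂ, f (b k) = c • b k := by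
    rintro _ ⟨a, ha, rfl⟩ k
    obtain ⟨c, hc⟩ := hb (ℜ (⟨a, ha⟩ : S)) k
    obtain ⟨d, hd⟩ := hb (ℑ (⟨a, ha⟩ : S)) k
    have h := congrArg Subtype.val (realPart_add_I_smul_imaginaryPart (⟨a, ha⟩ : S))
    refine ⟨c + Complex.I * d, ?_⟩
    change toEuclideanLin a (b k) = _
    have h' : a = ((ℜ (⟨a, ha⟩ : S) : S) : Matrix n n ℂ) +
      Complex.I • ((ℑ (⟨a, ha⟩ : S) : S) : Matrix n n ℂ) := h.symm
    rw [h', map_add, map_smul, LinearMap.add_apply, LinearMap.smul_apply, add_smul, mul_smul,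
      ← hc, ← hd]
  have h := finrank_le_of_forall_exists_smul_basis b W hW
  rwa [LinearEquiv.finrank_map_eq, finrank_euclideanSpace] at h
end

section
/- Let m and n be nonempty finite types with decidable equality, with d₁ := Fintype.card m and d₂ := Fintype.card n. Consider the set W of matrices X : Matrix (m × n) (m × n) ℂ of local form X = A ⊗ₖ 1 + 1 ⊗ₖ B with A : Matrix m m ℂ skew-Hermitian (Aᴴ = -A) and B : Matrix n n ℂ skew-Hermitian. Then W is an ℝ-submodule of Matrix (m × n) (m × n) ℂ and its real dimension is finrank ℝ W = d₁² + d₂² - 1. (This is equation (8) of the paper for two factors: the dimension of the group of TPS-preserving unitaries, at the Lie algebra level.) -/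
open Matrix Kronecker

/-- Multiplication by `I` exchanges self-adjoint and skew-adjoint elements, so the skew-adjoint
elements have half the real dimension of the whole space. -/
theorem two_mul_finrank_skewAdjoint (E : Type*) [AddCommGroup E] [Module ℂ E] [StarAddMonoid E]
    [StarModule ℂ E] [FiniteDimensional ℝ E] :
    2 * Module.finrank ℝ (skewAdjoint E) = Module.finrank ℝ E := by
  have hself : FiniteDimensional ℝ (selfAdjoint E) :=
    inferInstanceAs (FiniteDimensional ℝ (selfAdjoint.submodule ℝ E))
  have hskew : FiniteDimensional ℝ (skewAdjoint E) :=
    inferInstanceAs (FiniteDimensional ℝ (skewAdjoint.submodule ℝ E))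
  have hsum := (StarModule.decomposeProdAdjoint ℝ E).finrank_eq
  rw [Module.finrank_prod] at hsum
  have hnull := (imaginaryPart (A := E)).finrank_range_add_finrank_ker
  rw [LinearMap.range_eq_top.2 imaginaryPart_surjective, finrank_top, ker_imaginaryPart] at hnull
  change _ + Module.finrank ℝ (selfAdjoint E) = _ at hnull
  lia

theorem finrank_skewAdjoint_matrix (m : Type*) [Fintype m] [DecidableEq m] :
    Module.finrank ℝ (skewAdjoint (Matrix m m ℂ)) = Fintype.card m ^ 2 := by
  have h := two_mul_finrank_skewAdjoint (Matrix m m ℂ)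
  rw [Module.finrank_matrix, Complex.finrank_real_complex] at h
  nlinarith

section LocalSum

variable (m n : Type*) [DecidableEq m] [DecidableEq n]

/-- The Kronecker sum `(A, B) ↦ A ⊗ₖ 1 + 1 ⊗ₖ B` on pairs of skew-Hermitian matrices. -/
def skewKroneckerSum [Fintype m] [Fintype n] :
    (skewAdjoint (Matrix m m ℂ) × skewAdjoint (Matrix n n ℂ)) →ₗ[ℝ]
      Matrix (m × n) (m × n) ℂ where
  toFun p := (p.1 : Matrix m m ℂ) ⊗ₖ (1 : Matrix n n ℂ) + (1 : Matrix m m ℂ) ⊗ₖ (p.2 : Matrix n n ℂ)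
  map_add' p q := by
    simp only [Prod.fst_add, Prod.snd_add, AddSubgroup.coe_add, add_kronecker, kronecker_add]
    abel
  map_smul' r p := by
    simp [smul_kronecker, kronecker_smul]

variable [Fintype m] [Fintype n]

/-- The scalar matrix `I` as a skew-Hermitian matrix. -/
def skewScalarI : skewAdjoint (Matrix m m ℂ) :=
  ⟨Complex.I • 1, by simp⟩

theorem ker_skewKroneckerSum [Nonempty m] [Nonempty n] :
    (skewKroneckerSum m n).ker = Submodule.span ℝ {(skewScalarI m, -skewScalarI n)} := by
  ext ⟨⟨A, hA⟩, ⟨B, hB⟩⟩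
  rw [LinearMap.mem_ker, Submodule.mem_span_singleton]
  constructor
  · intro h
    obtain ⟨a₀⟩ := ‹Nonempty m›
    obtain ⟨b₀⟩ := ‹Nonempty n›
    have entry (a c : m) (b d : n) :
        A a c * (1 : Matrix n n ℂ) b d + (1 : Matrix m m ℂ) a c * B b d = 0 :=
      congrFun (congrFun h (a, b)) (c, d)
    have hre : (A a₀ a₀).re = 0 := by
      have h₁ : star (A a₀ a₀) = -A a₀ a₀ := congrFun (congrFun (show Aᴴ = -A from hA) a₀) a₀
      have h₂ := congrArg Complex.re h₁
      simp only [Complex.star_def, Complex.conj_re, Complex.neg_re] at h₂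
      linarith
    have hI : ((A a₀ a₀).im : ℂ) * Complex.I = A a₀ a₀ := by
      apply Complex.ext <;> simp [hre]
    have h₀ := entry a₀ a₀ b₀ b₀
    simp only [one_apply_eq, mul_one, one_mul] at h₀
    refine ⟨(A a₀ a₀).im, Prod.ext (Subtype.ext ?_) (Subtype.ext ?_)⟩
    · ext a c
      have h₁ := entry a c b₀ b₀
      simp only [one_apply_eq, mul_one] at h₁
      change ((A a₀ a₀).im : ℝ) • (Complex.I • (1 : Matrix m m ℂ) a c) = A a c
      rw [Complex.real_smul, smul_eq_mul, ← mul_assoc, hI]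
      linear_combination (1 : Matrix m m ℂ) a c * h₀ - h₁
    · ext b d
      have h₁ := entry a₀ a₀ b d
      simp only [one_apply_eq, one_mul] at h₁
      change ((A a₀ a₀).im : ℝ) • -(Complex.I • (1 : Matrix n n ℂ) b d) = B b d
      rw [Complex.real_smul, smul_eq_mul, mul_neg, ← mul_assoc, hI]
      linear_combination -h₁
  · rintro ⟨r, h⟩
    rw [← h, map_smul]
    have hz : skewKroneckerSum m n (skewScalarI m, -skewScalarI n) = 0 := by
      ext ⟨a, b⟩ ⟨c, d⟩
      simp [skewKroneckerSum, skewScalarI]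
      ring
    rw [hz, smul_zero]

theorem finrank_range_skewKroneckerSum [Nonempty m] [Nonempty n] :
    Module.finrank ℝ (skewKroneckerSum m n).range =
      Fintype.card m ^ 2 + Fintype.card n ^ 2 - 1 := by
  have hm : FiniteDimensional ℝ (skewAdjoint (Matrix m m ℂ)) :=
    inferInstanceAs (FiniteDimensional ℝ (skewAdjoint.submodule ℝ (Matrix m m ℂ)))
  have hn : FiniteDimensional ℝ (skewAdjoint (Matrix n n ℂ)) :=
    inferInstanceAs (FiniteDimensional ℝ (skewAdjoint.submodule ℝ (Matrix n n ℂ)))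
  have hne : (skewScalarI m, -skewScalarI n) ≠ 0 := by
    intro h
    have h₁ : Complex.I • (1 : Matrix m m ℂ) = 0 := congrArg (fun p => (p.1 : Matrix m m ℂ)) h
    simp at h₁
  have hnull := (skewKroneckerSum m n).finrank_range_add_finrank_ker
  rw [ker_skewKroneckerSum, finrank_span_singleton hne, Module.finrank_prod,
    finrank_skewAdjoint_matrix, finrank_skewAdjoint_matrix] at hnull
  lia

end LocalSum

theorem finrank_local_skewHermitian_submodule
    {m n : Type*} [Fintype m] [Fintype n] [DecidableEq m] [DecidableEq n]
    [Nonempty m] [Nonempty n] :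
    ∃ W : Submodule ℝ (Matrix (m × n) (m × n) ℂ),
      (W : Set (Matrix (m × n) (m × n) ℂ)) =
        {X | ∃ (A : Matrix m m ℂ) (B : Matrix n n ℂ),
          Aᴴ = -A ∧ Bᴴ = -B ∧ X = A ⊗ₖ (1 : Matrix n n ℂ) + (1 : Matrix m m ℂ) ⊗ₖ B} ∧
      Module.finrank ℝ W = (Fintype.card m) ^ 2 + (Fintype.card n) ^ 2 - 1 := by
  refine ⟨(skewKroneckerSum m n).range, ?_, finrank_range_skewKroneckerSum m n⟩
  ext X
  constructor
  · rintro ⟨⟨⟨A, hA⟩, ⟨B, hB⟩⟩, rfl⟩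
    exact ⟨A, B, hA, hB, rfl⟩
  · rintro ⟨A, B, hA, hB, rfl⟩
    exact ⟨(⟨A, hA⟩, ⟨B, hB⟩), rfl⟩
end

section
/- Let m and n be nonempty finite types with decidable equality, with d₁ := Fintype.card m and d₂ := Fintype.card n. Let T be a set of matrices in Matrix (m × n) (m × n) ℂ such that every X ∈ T can be written as X = A ⊗ₖ 1 + 1 ⊗ₖ B for some skew-Hermitian A : Matrix m m ℂ and skew-Hermitian B : Matrix n n ℂ, and such that the elements of T pairwise commute. Then the real dimension of the span satisfies finrank ℝ (Submodule.span ℝ T) ≤ d₁ + d₂ - 1. (This is equation (9) of the paper for two factors: any commutative subgroup of the TPS-preserving unitary group has dimension at most d₁ + d₂ - 1.) -/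
open Matrix Kronecker

/-- If two sums of local operators commute, then so do their local components. -/
theorem commute_of_commute_kronecker_add
    {R m n : Type*} [Field R] [CharZero R] [Fintype m] [Fintype n] [DecidableEq m] [DecidableEq n]
    [Nonempty m] [Nonempty n] {A A' : Matrix m m R} {B B' : Matrix n n R}
    (h : Commute (A ⊗ₖ (1 : Matrix n n R) + (1 : Matrix m m R) ⊗ₖ B)
      (A' ⊗ₖ (1 : Matrix n n R) + (1 : Matrix m m R) ⊗ₖ B')) :
    Commute A A' ∧ Commute B B' := by
  have key : (A * A' - A' * A) ⊗ₖ (1 : Matrix n n R) +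
      (1 : Matrix m m R) ⊗ₖ (B * B' - B' * B) = 0 := by
    have h1 := sub_eq_zero.mpr h.eq
    simp only [add_mul, mul_add, ← mul_kronecker_mul, one_mul, mul_one] at h1
    ext ⟨i, j⟩ ⟨k, l⟩
    have h2 := congrFun (congrFun h1 (i, j)) (k, l)
    simp only [Matrix.add_apply, Matrix.sub_apply, kronecker_apply, Matrix.zero_apply] at h2 ⊢
    linear_combination h2
  have entry (i j k l) : (A * A' - A' * A) i k * (1 : Matrix n n R) j l +
      (1 : Matrix m m R) i k * (B * B' - B' * B) j l = 0 :=
    congrFun (congrFun key (i, j)) (k, l)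
  have trA : (A * A' - A' * A).trace = 0 := by rw [trace_sub, trace_mul_comm, sub_self]
  have trB : (B * B' - B' * B).trace = 0 := by rw [trace_sub, trace_mul_comm, sub_self]
  have hm : (Fintype.card m : R) ≠ 0 := Nat.cast_ne_zero.mpr Fintype.card_ne_zero
  have hn : (Fintype.card n : R) ≠ 0 := Nat.cast_ne_zero.mpr Fintype.card_ne_zero
  constructor
  · refine sub_eq_zero.mp (Matrix.ext fun i k => ?_)
    have hs := Finset.sum_congr rfl fun j (_ : j ∈ Finset.univ) => entry i j k j
    simp only [Matrix.trace, diag_apply] at trB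
    simp [Finset.sum_add_distrib, ← Finset.mul_sum, -Matrix.sub_apply, trB, hn] at hs
    exact hs
  · refine sub_eq_zero.mp (Matrix.ext fun j l => ?_)
    have hs := Finset.sum_congr rfl fun i (_ : i ∈ Finset.univ) => entry i j i l
    simp only [Matrix.trace, diag_apply] at trA
    simp [Finset.sum_add_distrib, ← Finset.sum_mul, -Matrix.sub_apply, trA, hm] at hs
    exact hs

/-- The real span of a commuting family of complex Hermitian matrices of size `n` has dimension
at most `n`. -/
theorem finrank_span_commuting_isHermitian_le
    {n : Type*} [Fintype n] [DecidableEq n] {S : Set (Matrix n n ℂ)}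
    (hS : ∀ A ∈ S, A.IsHermitian) (hcomm : ∀ A ∈ S, ∀ B ∈ S, Commute A B) :
    Module.finrank ℝ (Submodule.span ℝ S) ≤ Fintype.card n := by
  let L : S → Module.End ℂ (EuclideanSpace ℂ n) := fun A => toEuclideanLin A.1
  have hL (A : S) : (L A).IsSymmetric := isSymmetric_toEuclideanLin_iff.mpr (hS A A.2)
  have hLcomm : Pairwise (Function.onFun Commute L) := fun A B _ => by
    change toEuclideanLin A.1 ∘ₗ toEuclideanLin B.1 = toEuclideanLin B.1 ∘ₗ toEuclideanLin A.1
    rw [← toLpLin_mul_same, ← toLpLin_mul_same, (hcomm A A.2 B B.2).eq]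
  have hspan : ⊤ ≤ Submodule.span ℂ
      {v : EuclideanSpace ℂ n | ∃ χ : S → ℂ, ∀ A, L A v = χ A • v} := by
    rw [← LinearMap.IsSymmetric.iSup_iInf_eq_top_of_commute hL hLcomm, iSup_le_iff]
    intro χ v hv
    refine Submodule.subset_span ⟨χ, fun A => ?_⟩
    exact Module.End.mem_eigenspace_iff.mp ((Submodule.mem_iInf _).mp hv A)
  let b := Module.Basis.ofSpan hspan
  have := Module.Finite.finite_basis b
  have := Fintype.ofFinite
    ((linearIndepOn_empty ℂ (id : EuclideanSpace ℂ n → _)).extend (Set.empty_subset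
      {v : EuclideanSpace ℂ n | ∃ χ : S → ℂ, ∀ A, L A v = χ A • v}))
  let f : Matrix n n ℂ →ₗ[ℝ] _ → ℝ :=
    { toFun := fun A i => (b.repr (toEuclideanLin A (b i)) i).re
      map_add' := fun A B => by ext i; simp
      map_smul' := fun r A => by
        ext i
        rw [← Complex.coe_smul, map_smul]
        simp [-Complex.coe_smul] }
  let D : Submodule ℝ (Matrix n n ℂ) :=
    { carrier := {A | ∀ i, ∃ r : ℝ, toEuclideanLin A (b i) = (r : ℂ) • b i}
      zero_mem' := fun i => ⟨0, by simp⟩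
      add_mem' := fun {A B} hA hB i => by
        obtain ⟨r, hr⟩ := hA i
        obtain ⟨s, hs⟩ := hB i
        exact ⟨r + s, by rw [map_add, LinearMap.add_apply, hr, hs, Complex.ofReal_add, add_smul]⟩
      smul_mem' := fun c A hA i => by
        obtain ⟨r, hr⟩ := hA i
        refine ⟨c * r, ?_⟩
        rw [← Complex.coe_smul, map_smul, LinearMap.smul_apply, hr, Complex.ofReal_mul, mul_smul] }
  have hSD : Submodule.span ℝ S ≤ D := Submodule.span_le.mpr fun A hA i => by
    obtain ⟨χ, hχ⟩ := Module.Basis.ofSpan_subset hspan (Set.mem_range_self i)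
    have hv := Module.End.hasEigenvalue_of_hasEigenvector
      ⟨Module.End.mem_eigenspace_iff.mpr (hχ ⟨A, hA⟩), b.ne_zero i⟩
    have hre := RCLike.conj_eq_iff_re.mp ((hL ⟨A, hA⟩).conj_eigenvalue_eq_self hv)
    exact ⟨RCLike.re (χ ⟨A, hA⟩), (hχ ⟨A, hA⟩).trans (congrArg (· • b i) hre.symm)⟩
  have hinj : Function.Injective (f.domRestrict D) := by
    rw [← LinearMap.ker_eq_bot, LinearMap.ker_eq_bot']
    rintro ⟨A, hA⟩ h
    refine Subtype.ext (toEuclideanLin.map_eq_zero_iff.mp (b.ext fun i => ?_))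
    obtain ⟨r, hr⟩ := hA i
    have hi : (b.repr (toEuclideanLin A (b i)) i).re = 0 := congrFun h i
    rw [hr] at hi ⊢
    have : r = 0 := by simpa [-Complex.coe_smul] using hi
    simp [this]
  calc Module.finrank ℝ (Submodule.span ℝ S) ≤ Module.finrank ℝ D := Submodule.finrank_mono hSD
    _ ≤ _ := LinearMap.finrank_le_finrank_of_injective hinj
    _ = Fintype.card n := by
      rw [Module.finrank_fintype_fun_eq_card, ← Module.finrank_eq_card_basis b,
        finrank_euclideanSpace]

theorem finrank_span_commuting_local_skewHermitian_le
    {m n : Type*} [Fintype m] [Fintype n] [DecidableEq m] [DecidableEq n]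
    [Nonempty m] [Nonempty n]
    (T : Set (Matrix (m × n) (m × n) ℂ))
    (hlocal : ∀ X ∈ T, ∃ (A : Matrix m m ℂ) (B : Matrix n n ℂ),
      Aᴴ = -A ∧ Bᴴ = -B ∧ X = A ⊗ₖ (1 : Matrix n n ℂ) + (1 : Matrix m m ℂ) ⊗ₖ B)
    (hcomm : ∀ X ∈ T, ∀ Y ∈ T, X * Y = Y * X) :
    Module.finrank ℝ (Submodule.span ℝ T) ≤ Fintype.card m + Fintype.card n - 1 := by
  have hlocal' (X : T) : ∃ (A : Matrix m m ℂ) (B : Matrix n n ℂ), A.IsHermitian ∧ B.IsHermitian ∧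
      X.1 = (Complex.I • A) ⊗ₖ (1 : Matrix n n ℂ) + (1 : Matrix m m ℂ) ⊗ₖ (Complex.I • B) := by
    obtain ⟨A, B, hA, hB, hX⟩ := hlocal X X.2
    refine ⟨-Complex.I • A, -Complex.I • B, ?_, ?_, ?_⟩
    · simp [IsHermitian, conjTranspose_smul, hA]
    · simp [IsHermitian, conjTranspose_smul, hB]
    · simpa [smul_smul] using hX
  choose A B hA hB hX using hlocal'
  have hAB (X Y : T) : Commute (A X) (A Y) ∧ Commute (B X) (B Y) := by
    have h : Commute X.1 Y.1 := hcomm X X.2 Y Y.2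
    rw [hX X, hX Y] at h
    have h' := commute_of_commute_kronecker_add h
    simpa [Commute.smul_left_iff₀, Commute.smul_right_iff₀] using h'
  have hdimA : Module.finrank ℝ (Submodule.span ℝ (insert 1 (Set.range A))) ≤ Fintype.card m := by
    refine finrank_span_commuting_isHermitian_le ?_ ?_
    · rintro _ (rfl | ⟨X, rfl⟩)
      exacts [isHermitian_one, hA X]
    · rintro _ (rfl | ⟨X, rfl⟩) _ (rfl | ⟨Y, rfl⟩)
      exacts [.one_left _, .one_left _, .one_right _, (hAB X Y).1]
  have hdimB : Module.finrank ℝ (Submodule.span ℝ (insert 1 (Set.range B))) ≤ Fintype.card n := by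
    refine finrank_span_commuting_isHermitian_le ?_ ?_
    · rintro _ (rfl | ⟨X, rfl⟩)
      exacts [isHermitian_one, hB X]
    · rintro _ (rfl | ⟨X, rfl⟩) _ (rfl | ⟨Y, rfl⟩)
      exacts [.one_left _, .one_left _, .one_right _, (hAB X Y).2]
  set VA := Submodule.span ℝ (insert 1 (Set.range A))
  set VB := Submodule.span ℝ (insert 1 (Set.range B))
  let f : VA × VB →ₗ[ℝ] Matrix (m × n) (m × n) ℂ :=
    { toFun := fun p => (Complex.I • p.1.1) ⊗ₖ 1 + 1 ⊗ₖ (Complex.I • p.2.1)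
      map_add' := fun p q => by
        simp only [Prod.fst_add, Prod.snd_add, Submodule.coe_add, smul_add, add_kronecker,
          kronecker_add]
        abel
      map_smul' := fun r p => by
        simp only [Prod.smul_fst, Prod.smul_snd, Submodule.coe_smul, RingHom.id_apply, smul_add,
          smul_comm Complex.I r, smul_kronecker r, kronecker_smul r] }
  have hTf : Submodule.span ℝ T ≤ LinearMap.range f := Submodule.span_le.mpr fun X h =>
    ⟨(⟨A ⟨X, h⟩, Submodule.subset_span (.inr ⟨_, rfl⟩)⟩,
      ⟨B ⟨X, h⟩, Submodule.subset_span (.inr ⟨_, rfl⟩)⟩), (hX ⟨X, h⟩).symm⟩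
  have hker : 0 < Module.finrank ℝ (LinearMap.ker f) := by
    refine Nat.pos_of_ne_zero (mt Submodule.finrank_eq_zero.mp ((Submodule.ne_bot_iff _).mpr ?_))
    refine ⟨(⟨1, Submodule.subset_span (.inl rfl)⟩,
      -⟨1, Submodule.subset_span (.inl rfl)⟩), ?_, fun h => ?_⟩
    · suffices Complex.I • (1 : Matrix (m × n) (m × n) ℂ) + Complex.I • 1 ⊗ₖ (-1) = 0 by
        simpa [f, smul_kronecker, kronecker_smul]
      rw [← neg_one_smul ℂ (1 : Matrix n n ℂ), kronecker_smul]
      simp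
    · exact one_ne_zero (congrArg (fun p => p.1.1) h)
  have hrank := f.finrank_range_add_finrank_ker
  rw [Module.finrank_prod] at hrank
  have := Submodule.finrank_mono hTf
  omega
end

section
/- Let m and n be nonempty finite types with decidable equality, and let H : Matrix (m × n) (m × n) ℂ be a matrix such that for every A : Matrix m m ℂ there exists A' : Matrix m m ℂ with H * (A ⊗ₖ 1) - (A ⊗ₖ 1) * H = A' ⊗ₖ 1. Then there exist H₁ : Matrix m m ℂ and H₂ : Matrix n n ℂ such that H = H₁ ⊗ₖ 1 + 1 ⊗ₖ H₂. (A Hamiltonian whose commutator action preserves the local observable algebra of a bipartite tensor product structure must be non-interacting, i.e., a Kronecker sum; this underlies the paper's Section 3 argument that a TPS-preserving Hamiltonian cannot entangle subsystems.) -/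
open Matrix Kronecker

theorem commutator_single_kronecker_one_apply
    {m n : Type*} [Fintype m] [Fintype n] [DecidableEq m] [DecidableEq n]
    (H : Matrix (m × n) (m × n) ℂ) (p q a c : m) (b d : n) :
    (H * (Matrix.single p q (1 : ℂ) ⊗ₖ (1 : Matrix n n ℂ)) -
        (Matrix.single p q (1 : ℂ) ⊗ₖ (1 : Matrix n n ℂ)) * H) (a, b) (c, d) =
      (if q = c then H (a, b) (p, d) else 0) - (if p = a then H (q, b) (c, d) else 0) := by
  simp [Matrix.mul_apply, Fintype.sum_prod_type, Matrix.single_apply, Matrix.one_apply,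
    ite_and, Finset.sum_ite_irrel]

theorem commutator_preserving_hamiltonian_is_kronecker_sum
    {m n : Type*} [Fintype m] [Fintype n] [DecidableEq m] [DecidableEq n]
    [Nonempty m] [Nonempty n]
    (H : Matrix (m × n) (m × n) ℂ)
    (hH : ∀ A : Matrix m m ℂ, ∃ A' : Matrix m m ℂ,
      H * (A ⊗ₖ (1 : Matrix n n ℂ)) - (A ⊗ₖ (1 : Matrix n n ℂ)) * H =
        A' ⊗ₖ (1 : Matrix n n ℂ)) :
    ∃ (H₁ : Matrix m m ℂ) (H₂ : Matrix n n ℂ),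
      H = H₁ ⊗ₖ (1 : Matrix n n ℂ) + (1 : Matrix m m ℂ) ⊗ₖ H₂ := by
  obtain ⟨a₀⟩ := ‹Nonempty m›
  obtain ⟨b₀⟩ := ‹Nonempty n›
  have key (p q : m) : ∃ A' : Matrix m m ℂ, ∀ a b c d,
      (if q = c then H (a, b) (p, d) else 0) - (if p = a then H (q, b) (c, d) else 0) =
        A' a c * (1 : Matrix n n ℂ) b d := by
    obtain ⟨A', hA'⟩ := hH (Matrix.single p q 1)
    refine ⟨A', fun a b c d => ?_⟩
    rw [← commutator_single_kronecker_one_apply, hA', Matrix.kroneckerMap_apply]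
  refine ⟨Matrix.of fun a c => H (a, b₀) (c, b₀) -
      (1 : Matrix m m ℂ) a c * H (a₀, b₀) (a₀, b₀),
    Matrix.of fun b d => H (a₀, b) (a₀, d), ?_⟩
  ext ⟨a, b⟩ ⟨c, d⟩
  simp only [Matrix.add_apply, Matrix.kroneckerMap_apply, Matrix.of_apply]
  by_cases hac : a = c
  · subst hac
    obtain ⟨A', hA'⟩ := key a a₀
    have h := hA' a b a₀ d
    have h₀ := hA' a b₀ a₀ b₀
    simp only [if_true, Matrix.one_apply_eq, mul_one, one_mul] at h h₀ ⊢
    rw [h₀, ← h]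
    ring
  · obtain ⟨A', hA'⟩ := key c c
    have h := hA' a b c d
    have h₀ := hA' a b₀ c b₀
    simp only [if_true, if_neg (Ne.symm hac), sub_zero, Matrix.one_apply_eq, mul_one,
      Matrix.one_apply_ne hac, zero_mul, add_zero] at h h₀ ⊢
    rw [h₀, h]
end

section
/- Let m and n be nonempty finite types with decidable equality, and let U ∈ Matrix.unitaryGroup (m × n) ℂ be a unitary matrix such that: (i) for every A : Matrix m m ℂ there exists A' : Matrix m m ℂ with U * (A ⊗ₖ 1) * Uᴴ = A' ⊗ₖ 1, and (ii) for every B : Matrix n n ℂ there exists B' : Matrix n n ℂ with U * (1 ⊗ₖ B) * Uᴴ = 1 ⊗ₖ B'. Then for all ρ₁ : Matrix m m ℂ and ρ₂ : Matrix n n ℂ, there exist σ₁ : Matrix m m ℂ and σ₂ : Matrix n n ℂ with U * (ρ₁ ⊗ₖ ρ₂) * Uᴴ = σ₁ ⊗ₖ σ₂. (This is the paper's Section 3 claim: a unitary evolution preserving the algebras of observables of a tensor product structure maps separable product states to product states, hence cannot entangle the subsystems.) -/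
open Matrix Kronecker

theorem algebra_preserving_unitary_maps_products_to_products
    {m n : Type*} [Fintype m] [Fintype n] [DecidableEq m] [DecidableEq n]
    [Nonempty m] [Nonempty n]
    (U : Matrix (m × n) (m × n) ℂ) (hU : U ∈ Matrix.unitaryGroup (m × n) ℂ)
    (h1 : ∀ A : Matrix m m ℂ, ∃ A' : Matrix m m ℂ,
      U * (A ⊗ₖ (1 : Matrix n n ℂ)) * Uᴴ = A' ⊗ₖ (1 : Matrix n n ℂ))
    (h2 : ∀ B : Matrix n n ℂ, ∃ B' : Matrix n n ℂ,
      U * ((1 : Matrix m m ℂ) ⊗ₖ B) * Uᴴ = (1 : Matrix m m ℂ) ⊗ₖ B') :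
    ∀ (ρ₁ : Matrix m m ℂ) (ρ₂ : Matrix n n ℂ),
      ∃ (σ₁ : Matrix m m ℂ) (σ₂ : Matrix n n ℂ),
        U * (ρ₁ ⊗ₖ ρ₂) * Uᴴ = σ₁ ⊗ₖ σ₂ := by
  intro ρ₁ ρ₂
  obtain ⟨σ₁, hσ₁⟩ := h1 ρ₁
  obtain ⟨σ₂, hσ₂⟩ := h2 ρ₂
  have hU' : Uᴴ * U = 1 := Matrix.mem_unitaryGroup_iff'.mp hU
  refine ⟨σ₁, σ₂, ?_⟩
  calc U * (ρ₁ ⊗ₖ ρ₂) * Uᴴ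
      = U * (ρ₁ ⊗ₖ (1 : Matrix n n ℂ)) * (Uᴴ * U) * ((1 : Matrix m m ℂ) ⊗ₖ ρ₂) * Uᴴ := by
        rw [hU', mul_one, mul_assoc U (ρ₁ ⊗ₖ (1 : Matrix n n ℂ)), ← Matrix.mul_kronecker_mul, mul_one, one_mul]
    _ = (U * (ρ₁ ⊗ₖ (1 : Matrix n n ℂ)) * Uᴴ) * (U * ((1 : Matrix m m ℂ) ⊗ₖ ρ₂) * Uᴴ) := by
        simp only [mul_assoc]
    _ = σ₁ ⊗ₖ σ₂ := by
        rw [hσ₁, hσ₂, ← Matrix.mul_kronecker_mul, mul_one, one_mul]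
end

section
/- Let m and n be nonempty finite types with decidable equality, and let U ∈ Matrix.unitaryGroup (m × n) ℂ be a unitary matrix such that: (i) for every A : Matrix m m ℂ there exists A' : Matrix m m ℂ with U * (A ⊗ₖ 1) * Uᴴ = A' ⊗ₖ 1, and (ii) for every B : Matrix n n ℂ there exists B' : Matrix n n ℂ with U * (1 ⊗ₖ B) * Uᴴ = 1 ⊗ₖ B'. Then there exist unitary matrices U₁ ∈ Matrix.unitaryGroup m ℂ and U₂ ∈ Matrix.unitaryGroup n ℂ such that (U : Matrix (m × n) (m × n) ℂ) = U₁ ⊗ₖ U₂. (A unitary preserving both local observable algebras of a bipartite tensor product structure is itself a local unitary; this underlies the paper's characterization of the TPS-preserving group U_TPS.) -/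
open Matrix Kronecker

/-- A unitary Kronecker product is a Kronecker product of unitaries. -/
theorem exists_unitary_factors_of_kronecker_mem_unitaryGroup
    {m n : Type*} [Fintype m] [Fintype n] [DecidableEq m] [DecidableEq n]
    [Nonempty m] [Nonempty n] (V : Matrix m m ℂ) (W : Matrix n n ℂ)
    (h : V ⊗ₖ W ∈ Matrix.unitaryGroup (m × n) ℂ) :
    ∃ U₁ ∈ Matrix.unitaryGroup m ℂ, ∃ U₂ ∈ Matrix.unitaryGroup n ℂ,
      V ⊗ₖ W = U₁ ⊗ₖ U₂ := by
  rw [Matrix.mem_unitaryGroup_iff, Matrix.star_eq_conjTranspose, Matrix.conjTranspose_kronecker,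
    ← Matrix.mul_kronecker_mul] at h
  have hentry (a c : m) (b d : n) :
      (V * Vᴴ) a c * (W * Wᴴ) b d = if a = c ∧ b = d then 1 else 0 := by
    simpa [Matrix.one_apply] using congrFun (congrFun h (a, b)) (c, d)
  obtain ⟨a₀⟩ := ‹Nonempty m›
  obtain ⟨b₀⟩ := ‹Nonempty n›
  have hdiag : (W * Wᴴ) b₀ b₀ = ((∑ k, Complex.normSq (W b₀ k) : ℝ) : ℂ) := by
    simp [Matrix.mul_apply, Complex.mul_conj]
  set r : ℝ := ∑ k, Complex.normSq (W b₀ k) with hr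
  have hV (a c : m) : (V * Vᴴ) a c * (r : ℂ) = (1 : Matrix m m ℂ) a c := by
    rw [← hdiag, hentry, Matrix.one_apply]
    simp
  have hr0 : (r : ℂ) ≠ 0 := fun h0 => by
    simpa [h0] using hV a₀ a₀
  have hrpos : 0 < r := lt_of_le_of_ne (Finset.sum_nonneg fun k _ => Complex.normSq_nonneg _)
    fun h0 => hr0 (by simp [← h0])
  have hW (b d : n) : (W * Wᴴ) b d = (r : ℂ) * (1 : Matrix n n ℂ) b d := by
    have h1 := hentry a₀ a₀ b d
    have h2 := hV a₀ a₀
    rw [Matrix.one_apply_eq] at h2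
    rw [Matrix.one_apply]
    simp only [true_and] at h1
    rw [← h1, ← mul_assoc, mul_comm (r : ℂ), h2, one_mul]
  have hs : ((√r : ℝ) : ℂ) * ((√r : ℝ) : ℂ) = r := by
    rw [← Complex.ofReal_mul, Real.mul_self_sqrt hrpos.le]
  have hs0 : ((√r : ℝ) : ℂ) ≠ 0 := fun h0 => hr0 (by rw [← hs, h0, zero_mul])
  refine ⟨((√r : ℝ) : ℂ) • V, ?_, ((√r : ℝ) : ℂ)⁻¹ • W, ?_, ?_⟩
  · rw [Matrix.mem_unitaryGroup_iff, Matrix.star_eq_conjTranspose]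
    ext a c
    rw [← hV a c, ← hs]
    simp [Matrix.conjTranspose_smul]
    ring
  · rw [Matrix.mem_unitaryGroup_iff, Matrix.star_eq_conjTranspose]
    ext b d
    simp [Matrix.conjTranspose_smul, hW b d, ← hs]
    field_simp
  · rw [Matrix.smul_kronecker, Matrix.kronecker_smul, smul_smul, mul_inv_cancel₀ hs0, one_smul]

theorem algebra_preserving_unitary_is_local
    {m n : Type*} [Fintype m] [Fintype n] [DecidableEq m] [DecidableEq n]
    [Nonempty m] [Nonempty n]
    (U : Matrix (m × n) (m × n) ℂ) (hU : U ∈ Matrix.unitaryGroup (m × n) ℂ)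
    (h1 : ∀ A : Matrix m m ℂ, ∃ A' : Matrix m m ℂ,
      U * (A ⊗ₖ (1 : Matrix n n ℂ)) * Uᴴ = A' ⊗ₖ (1 : Matrix n n ℂ))
    (h2 : ∀ B : Matrix n n ℂ, ∃ B' : Matrix n n ℂ,
      U * ((1 : Matrix m m ℂ) ⊗ₖ B) * Uᴴ = (1 : Matrix m m ℂ) ⊗ₖ B') :
    ∃ U₁ ∈ Matrix.unitaryGroup m ℂ, ∃ U₂ ∈ Matrix.unitaryGroup n ℂ,
      U = U₁ ⊗ₖ U₂ := by
  choose φ hφ using h1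
  choose ψ hψ using h2
  have hUU : Uᴴ * U = 1 := Matrix.mem_unitaryGroup_iff'.mp hU
  have hprod (A : Matrix m m ℂ) (B : Matrix n n ℂ) : U * (A ⊗ₖ B) * Uᴴ = φ A ⊗ₖ ψ B := by
    calc U * (A ⊗ₖ B) * Uᴴ = U * (A ⊗ₖ 1) * (Uᴴ * U) * (1 ⊗ₖ B) * Uᴴ := by
          rw [hUU, mul_one, mul_assoc U (A ⊗ₖ 1), ← Matrix.mul_kronecker_mul, mul_one, one_mul]
      _ = (U * (A ⊗ₖ 1) * Uᴴ) * (U * (1 ⊗ₖ B) * Uᴴ) := by simp only [mul_assoc]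
      _ = φ A ⊗ₖ ψ B := by
          rw [hφ, hψ, ← Matrix.mul_kronecker_mul, mul_one, one_mul]
  have hne : U ≠ 0 := by
    rintro rfl
    simp at hUU
  obtain ⟨⟨y₁, y₂⟩, ⟨j, l⟩, hc⟩ : ∃ y z, U y z ≠ 0 := by
    by_contra! h0
    exact hne (Matrix.ext h0)
  have hentry (a i : m) (b k : n) : U (a, b) (i, k) * star (U (y₁, y₂) (j, l)) =
      φ (Matrix.single i j 1) a y₁ * ψ (Matrix.single k l 1) b y₂ := by
    have h := congrFun (congrFun (hprod (Matrix.single i j 1) (Matrix.single k l 1)) (a, b))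
      (y₁, y₂)
    rw [Matrix.single_kronecker_single, Matrix.kronecker_apply] at h
    rw [← h, Matrix.mul_apply, Finset.sum_eq_single (j, l)]
    · simp
    · intro z _ hz
      simp [Matrix.mul_single_apply_of_ne _ _ _ _ _ hz]
    · simp
  have hfac : U = (Matrix.of fun a i => φ (Matrix.single i j 1) a y₁) ⊗ₖ
      (Matrix.of fun b k => ψ (Matrix.single k l 1) b y₂ / star (U (y₁, y₂) (j, l))) := by
    ext ⟨a, b⟩ ⟨i, k⟩
    rw [Matrix.kronecker_apply, Matrix.of_apply, Matrix.of_apply, ← mul_div_assoc, ← hentry,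
      mul_div_cancel_right₀ _ (star_ne_zero.mpr hc)]
  rw [hfac] at hU
  obtain ⟨U₁, hU₁, U₂, hU₂, h⟩ := exists_unitary_factors_of_kronecker_mem_unitaryGroup _ _ hU
  exact ⟨U₁, hU₁, U₂, hU₂, hfac.trans h⟩
end

section
/- Let m and n be nonempty finite types, and let T : ((m × n) → ℂ) →ₗ[ℂ] ((m × n) → ℂ) be a linear map such that for all vectors v : m → ℂ and w : n → ℂ there exist x : m → ℂ and y : n → ℂ with T (fun p => v p.1 * w p.2) = (fun p => x p.1 * w p.2 + v p.1 * y p.2). Then there exist matrices T₁ : Matrix m m ℂ and T₂ : Matrix n n ℂ such that for all z : m × n → ℂ, T z = (T₁ ⊗ₖ 1 + 1 ⊗ₖ T₂).mulVec z. (A linear operator whose value at every product vector lies in the tangent space of the set of product vectors is a Kronecker sum of local operators; this is the key lemma behind the claim that a unitary flow preserving product states has a non-interacting generator.) -/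
open Matrix Kronecker

/-- A `2 × 2` block of an element `x ⊗ w + v ⊗ y` of the tangent space at `v ⊗ w` is annihilated by
the product of the functionals `v a' e_a - v a e_a'` and `w b' e_b - w b e_b'`. -/
theorem tangent_minor_eq_zero {m n R : Type*} [CommRing R] {S : m × n → R} {v x : m → R}
    {w y : n → R} (hS : S = fun p => x p.1 * w p.2 + v p.1 * y p.2) (a a' : m) (b b' : n) :
    v a' * w b' * S (a, b) - v a' * w b * S (a, b') - v a * w b' * S (a', b)
      + v a * w b * S (a', b') = 0 := by
  subst hS
  ring

theorem tangent_to_products_is_kronecker_sum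
    {m n : Type*} [Fintype m] [Fintype n] [DecidableEq m] [DecidableEq n]
    [Nonempty m] [Nonempty n]
    (T : ((m × n) → ℂ) →ₗ[ℂ] ((m × n) → ℂ))
    (hT : ∀ (v : m → ℂ) (w : n → ℂ), ∃ (x : m → ℂ) (y : n → ℂ),
      T (fun p => v p.1 * w p.2) = fun p => x p.1 * w p.2 + v p.1 * y p.2) :
    ∃ (T₁ : Matrix m m ℂ) (T₂ : Matrix n n ℂ),
      ∀ z : m × n → ℂ,
        T z = (T₁ ⊗ₖ (1 : Matrix n n ℂ) + (1 : Matrix m m ℂ) ⊗ₖ T₂).mulVec z := by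
  obtain ⟨t, ht⟩ : ∃ t : m → n → m → n → ℂ,
      ∀ a b c d, t a b c d = T (Pi.single (c, d) 1) (a, b) := ⟨_, fun _ _ _ _ => rfl⟩
  have minor (v : m → ℂ) (w : n → ℂ) (a a' : m) (b b' : n) :
      v a' * w b' * T (fun p => v p.1 * w p.2) (a, b)
        - v a' * w b * T (fun p => v p.1 * w p.2) (a, b')
        - v a * w b' * T (fun p => v p.1 * w p.2) (a', b)
        + v a * w b * T (fun p => v p.1 * w p.2) (a', b') = 0 := by
    obtain ⟨x, y, h⟩ := hT v w
    exact tangent_minor_eq_zero h a a' b b'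
  have prod_single (c : m) (d : n) :
      (fun p : m × n => (Pi.single c 1 : m → ℂ) p.1 * (Pi.single d 1 : n → ℂ) p.2)
        = Pi.single (c, d) 1 := by
    ext ⟨a, b⟩
    by_cases h : a = c <;> by_cases h' : b = d <;> simp [h, h']
  have single_prod_add (c : m) (d d' : n) :
      (fun p : m × n => (Pi.single c 1 : m → ℂ) p.1 * (Pi.single d 1 + Pi.single d' 1 : n → ℂ) p.2)
        = Pi.single (c, d) 1 + Pi.single (c, d') 1 := by
    rw [← prod_single, ← prod_single]; ext p; simp only [Pi.add_apply]; ring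
  have add_prod_single (c c' : m) (d : n) :
      (fun p : m × n => (Pi.single c 1 + Pi.single c' 1 : m → ℂ) p.1 * (Pi.single d 1 : n → ℂ) p.2)
        = Pi.single (c, d) 1 + Pi.single (c', d) 1 := by
    rw [← prod_single, ← prod_single]; ext p; simp only [Pi.add_apply]; ring
  have add_prod_add (c c' : m) (d d' : n) :
      (fun p : m × n => (Pi.single c 1 + Pi.single c' 1 : m → ℂ) p.1
          * (Pi.single d 1 + Pi.single d' 1 : n → ℂ) p.2)
        = Pi.single (c, d) 1 + Pi.single (c, d') 1 + Pi.single (c', d) 1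
          + Pi.single (c', d') 1 := by
    simp_rw [← prod_single]; ext p; simp only [Pi.add_apply]; ring
  have off {a c : m} {b d : n} (hac : a ≠ c) (hbd : b ≠ d) : t a b c d = 0 := by
    have h := minor (Pi.single c 1) (Pi.single d 1) a c b d
    rw [prod_single] at h
    simpa [hac, hbd, ← ht] using h
  have left {a c : m} (hac : a ≠ c) (b b' : n) : t a b c b = t a b' c b' := by
    rcases eq_or_ne b b' with rfl | hb
    · rfl
    have h := minor (Pi.single c 1) (Pi.single b 1 + Pi.single b' 1) a c b b'
    rw [single_prod_add] at h
    simp [hac, hb, hb.symm, ← ht, off] at h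
    linear_combination h
  have right {b d : n} (hbd : b ≠ d) (a a' : m) : t a b a d = t a' b a' d := by
    rcases eq_or_ne a a' with rfl | ha
    · rfl
    have h := minor (Pi.single a 1 + Pi.single a' 1) (Pi.single d 1) a a' b d
    rw [add_prod_single] at h
    simp [hbd, ha, ha.symm, ← ht, off] at h
    linear_combination h
  have diag (a a' : m) (b b' : n) :
      t a b a b + t a' b' a' b' = t a b' a b' + t a' b a' b := by
    rcases eq_or_ne a a' with rfl | ha
    · ring
    rcases eq_or_ne b b' with rfl | hb
    · ring
    have h := minor (Pi.single a 1 + Pi.single a' 1) (Pi.single b 1 + Pi.single b' 1) a a' b b'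
    rw [add_prod_add] at h
    simp [hb, hb.symm, ha, ha.symm, ← ht, off] at h
    linear_combination h - left ha b b' + left ha.symm b b' - right hb a a' + right hb.symm a a'
  obtain ⟨a₀⟩ := ‹Nonempty m›
  obtain ⟨b₀⟩ := ‹Nonempty n›
  refine ⟨Matrix.of fun a c => t a b₀ c b₀,
    Matrix.of fun b d => t a₀ b a₀ d - if b = d then t a₀ b₀ a₀ b₀ else 0, fun z => ?_⟩
  rw [← LinearMap.toMatrix'_mulVec]
  congr 1
  ext ⟨a, b⟩ ⟨c, d⟩
  rw [LinearMap.toMatrix'_apply, ← ht]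
  rcases eq_or_ne a c with rfl | hac <;> rcases eq_or_ne b d with rfl | hbd
  · simp
    linear_combination diag a a₀ b b₀
  · simp [hbd, right hbd a a₀]
  · simp [hac, left hac b b₀]
  · simp [hac, hbd, off]
end
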